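/- arXiv:1707.07654 — 2 statements merged into one kernel-verified Lean document; each statement's English description precedes it below -/
import Mathlib

section
/- Let p be a prime and let A be a subgroup of an abelian group B such that p • b ∈ A for every b ∈ B (so B/A is an elementary abelian p-group). Write T_P A and T_P B for the subgroups of A and B consisting of torsion elements whose order is coprime to p. Then A = B (equivalently, the inclusion A ↪ B is an isomorphism) if and only if the homomorphism A/T_P A → B/T_P B induced by the inclusion is an isomorphism. -/
/-- The subgroup of an abelian group consisting of the torsion elements whose
(finite) order is coprime to `p`; equivalently, elements annihilated by some positive
integer coprime to `p`. -/
def primeComplTorsion {B : Type*} [AddCommGroup B] (p : ℕ) : AddSubgroup B where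
  carrier := {x | ∃ n : ℕ, 0 < n ∧ n.Coprime p ∧ n • x = 0}
  zero_mem' := ⟨1, one_pos, Nat.coprime_one_left p, smul_zero 1⟩
  add_mem' := by
    rintro x y ⟨m, hm, hmp, hmx⟩ ⟨n, hn, hnp, hny⟩
    refine ⟨m * n, Nat.mul_pos hm hn, Nat.Coprime.mul hmp hnp, ?_⟩
    have hx : (m * n) • x = 0 := by rw [mul_comm, mul_smul, hmx, smul_zero]
    have hy : (m * n) • y = 0 := by rw [mul_smul, hny, smul_zero]
    rw [smul_add, hx, hy, add_zero]
  neg_mem' := by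
    rintro x ⟨n, hn, hnp, hnx⟩
    exact ⟨n, hn, hnp, by rw [smul_neg, hnx, neg_zero]⟩

/-- The inclusion `A ↪ B` carries the coprime-to-`p` torsion of `A` into that of `B`. -/
theorem primeComplTorsion_le_comap {B : Type*} [AddCommGroup B] (p : ℕ) (A : AddSubgroup B) :
    primeComplTorsion (B := ↥A) p ≤ (primeComplTorsion (B := B) p).comap A.subtype := by
  rintro x ⟨n, hn, hnp, hnx⟩
  exact ⟨n, hn, hnp, by simpa using congrArg A.subtype hnx⟩

/-- If `p • b ∈ A` for all `b : B`, then `A` contains the coprime-to-`p` torsion of `B`. -/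
theorem primeComplTorsion_le_of_nsmul_mem {B : Type*} [AddCommGroup B] {p : ℕ}
    {A : AddSubgroup B} (hA : ∀ b : B, p • b ∈ A) : primeComplTorsion (B := B) p ≤ A := by
  rintro x ⟨n, -, hnp, hnx⟩
  obtain ⟨u, v, huv⟩ := Nat.isCoprime_iff_coprime.mpr hnp
  have hx : x = v • (p • x) := by
    simpa [add_smul, mul_smul, hnx] using congrArg (fun m : ℤ => m • x) huv.symm
  rw [hx]
  exact A.zsmul_mem (hA x) v

/-- The map `A/T_P A → B/T_P B` induced by the inclusion is injective. -/
theorem map_primeComplTorsion_injective {B : Type*} [AddCommGroup B] (p : ℕ)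
    (A : AddSubgroup B) : Function.Injective
      (QuotientAddGroup.map (primeComplTorsion (B := ↥A) p) (primeComplTorsion (B := B) p)
        A.subtype (primeComplTorsion_le_comap p A)) := by
  rw [injective_iff_map_eq_zero]
  intro q hq
  obtain ⟨a, rfl⟩ := QuotientAddGroup.mk_surjective q
  rw [QuotientAddGroup.map_mk, QuotientAddGroup.eq_zero_iff] at hq
  obtain ⟨n, hn, hnp, hna⟩ := hq
  exact (QuotientAddGroup.eq_zero_iff a).mpr ⟨n, hn, hnp, Subtype.ext hna⟩

/-- Let `p` be a prime and `A` a subgroup of an abelian group `B` with `p • b ∈ A` for all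
`b : B` (so `B/A` is an elementary abelian `p`-group). Writing `T_P A`, `T_P B` for the
subgroups of torsion elements of order coprime to `p`, we have `A = B` if and only if the
map `A/T_P A → B/T_P B` induced by the inclusion is an isomorphism. -/
theorem stmt_1 {B : Type*} [AddCommGroup B] (p : ℕ) (hp : p.Prime)
    (A : AddSubgroup B) (hA : ∀ b : B, p • b ∈ A) :
    A = ⊤ ↔ Function.Bijective
      (QuotientAddGroup.map (primeComplTorsion (B := ↥A) p) (primeComplTorsion (B := B) p)
        A.subtype (primeComplTorsion_le_comap p A)) := by
  refine ⟨fun h => ⟨map_primeComplTorsion_injective p A, fun q => ?_⟩, fun h => ?_⟩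
  · obtain ⟨b, rfl⟩ := QuotientAddGroup.mk_surjective q
    exact ⟨QuotientAddGroup.mk ⟨b, h ▸ AddSubgroup.mem_top b⟩, rfl⟩
  · refine (AddSubgroup.eq_top_iff' A).mpr fun b => ?_
    obtain ⟨q, hq⟩ := h.surjective (QuotientAddGroup.mk b)
    obtain ⟨a, rfl⟩ := QuotientAddGroup.mk_surjective q
    rw [QuotientAddGroup.map_mk, QuotientAddGroup.eq] at hq
    simpa using A.add_mem a.2 (primeComplTorsion_le_of_nsmul_mem hA hq)
end

section
/- Let p be a prime and let A and B be additive subgroups of ℚ such that 1 ∈ A, 1 ∈ B, 1/p ∉ A, 1/p ∉ B, and the only additive group homomorphisms A → B and B → A are zero. Inside ℚ ⊕ ℚ let H = { (a, b) : a ∈ A, b ∈ B } and let G be the subgroup generated by H together with the element (1/p, 1/p). Then the quotient G/H is cyclic of order p, but G is not isomorphic to H as an abelian group. -/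
/-- If `A` contains `1` but not `1 / p`, then `n / p ∈ A` forces `p` to divide `n`. -/
theorem dvd_of_mul_one_div_mem {p : ℕ} (hp : p.Prime) {A : AddSubgroup ℚ} (hA1 : (1 : ℚ) ∈ A)
    (hAp : (1 / p : ℚ) ∉ A) {n : ℤ} (hn : (n : ℚ) * (1 / p) ∈ A) : (p : ℤ) ∣ n := by
  by_contra hdvd
  obtain ⟨u, v, huv⟩ := (Nat.prime_iff_prime_int.mp hp).coprime_iff_not_dvd.mpr hdvd
  have hp0 : (p : ℚ) ≠ 0 := mod_cast hp.ne_zero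
  have huv' : (u : ℚ) * p + v * n = 1 := mod_cast huv
  have heq : (1 / p : ℚ) = u • (1 : ℚ) + v • ((n : ℚ) * (1 / p)) := by
    simp only [zsmul_eq_mul]
    field_simp
    linarith
  exact hAp (heq ▸ A.add_mem (A.zsmul_mem hA1 u) (A.zsmul_mem hn v))

theorem mem_prod_sup_closure_iff {p : ℕ} {A B : AddSubgroup ℚ} {x : ℚ × ℚ} :
    x ∈ A.prod B ⊔ AddSubgroup.closure {((1 / p : ℚ), (1 / p : ℚ))} ↔
      ∃ n : ℤ, x.1 - n * (1 / p) ∈ A ∧ x.2 - n * (1 / p) ∈ B := by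
  rw [AddSubgroup.mem_sup]
  constructor
  · rintro ⟨y, hy, z, hz, rfl⟩
    obtain ⟨n, rfl⟩ := AddSubgroup.mem_closure_singleton.mp hz
    exact ⟨n, by simpa using hy.1, by simpa using hy.2⟩
  · rintro ⟨n, h₁, h₂⟩
    refine ⟨x - n • ((1 / p : ℚ), (1 / p : ℚ)), ⟨?_, ?_⟩, _,
      AddSubgroup.mem_closure_singleton.mpr ⟨n, rfl⟩, sub_add_cancel _ _⟩
    · simpa using h₁
    · simpa using h₂

/-- If `Hom(A, B) = 0`, then every homomorphism `A → ℚ` whose `p`-multiple lands in `B` is zero. -/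
theorem eq_zero_of_natCast_mul_mem {p : ℕ} (hp : p ≠ 0) {A B : AddSubgroup ℚ}
    (hAB : ∀ f : A →+ B, f = 0) (f : A →+ ℚ) (hf : ∀ a, (p : ℚ) * f a ∈ B) (a : A) : f a = 0 := by
  have h := congrArg Subtype.val
    (DFunLike.congr_fun (hAB (((AddMonoidHom.mulLeft (p : ℚ)).comp f).codRestrict B hf)) a)
  have h' : (p : ℚ) * f a = 0 := h
  exact (mul_eq_zero.mp h').resolve_left (mod_cast hp)

theorem natCast_mul_mem_of_sub_mem {p : ℕ} (hp : p ≠ 0) {B : AddSubgroup ℚ} (hB1 : (1 : ℚ) ∈ B)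
    {y : ℚ}
    {n : ℤ} (h : y - n * (1 / p) ∈ B) : (p : ℚ) * y ∈ B := by
  have hp0 : (p : ℚ) ≠ 0 := mod_cast hp
  have heq : (p : ℚ) * y = p • (y - n * (1 / p)) + n • (1 : ℚ) := by
    simp only [zsmul_eq_mul, nsmul_eq_mul]
    field_simp
    ring
  exact heq ▸ B.add_mem (B.nsmul_mem h p) (B.zsmul_mem hB1 n)

/-- (Dugas' counterexample.) Let `p` be a prime and `A, B ≤ ℚ` additive subgroups with
`1 ∈ A`, `1 ∈ B`, `1/p ∉ A`, `1/p ∉ B`, and such that the only additive homomorphisms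
`A → B` and `B → A` are zero. Inside `ℚ ⊕ ℚ`, let `H = {(a, b) : a ∈ A, b ∈ B}` and let `G`
be the subgroup generated by `H` together with `(1/p, 1/p)`. Then `G/H` is cyclic of order
`p`, but `G` is not isomorphic to `H` as an abelian group. -/
theorem stmt_10 (p : ℕ) (hp : p.Prime) (A B : AddSubgroup ℚ)
    (hA1 : (1 : ℚ) ∈ A) (hB1 : (1 : ℚ) ∈ B)
    (hAp : (1 / p : ℚ) ∉ A) (hBp : (1 / p : ℚ) ∉ B)
    (hAB : ∀ f : A →+ B, f = 0) (hBA : ∀ f : B →+ A, f = 0)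
    (H G : AddSubgroup (ℚ × ℚ))
    (hH : H = A.prod B)
    (hG : G = H ⊔ AddSubgroup.closure {((1 / p : ℚ), (1 / p : ℚ))}) :
    Nonempty ((↥G ⧸ H.addSubgroupOf G) ≃+ ZMod p) ∧ ¬ Nonempty (↥G ≃+ ↥H) := by
  have hp0 : (p : ℚ) ≠ 0 := mod_cast hp.ne_zero
  have memG (x : ℚ × ℚ) : x ∈ G ↔ ∃ n : ℤ, x.1 - n * (1 / p) ∈ A ∧ x.2 - n * (1 / p) ∈ B :=
    hG ▸ hH ▸ mem_prod_sup_closure_iff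
  have memH (x : ℚ × ℚ) : x ∈ H ↔ x.1 ∈ A ∧ x.2 ∈ B := hH ▸ Iff.rfl
  have hg : ((1 / p : ℚ), (1 / p : ℚ)) ∈ G :=
    (memG _).mpr ⟨1, by simp, by simp⟩
  constructor
  · have : Fact p.Prime := ⟨hp⟩
    let q : ↥G ⧸ H.addSubgroupOf G := QuotientAddGroup.mk ⟨_, hg⟩
    have hq : addOrderOf q = p := by
      refine addOrderOf_eq_prime ?_ fun h => ?_
      · refine (QuotientAddGroup.eq_zero_iff (p • (⟨_, hg⟩ : G))).mpr ?_
        rw [AddSubgroup.mem_addSubgroupOf, memH]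
        simp [hp0, hA1, hB1]
      · have h' := (QuotientAddGroup.eq_zero_iff (⟨_, hg⟩ : G)).mp h
        rw [AddSubgroup.mem_addSubgroupOf, memH] at h'
        exact hAp h'.1
    have hgen (x : ↥G ⧸ H.addSubgroupOf G) : x ∈ AddSubgroup.zmultiples q := by
      obtain ⟨x, rfl⟩ := QuotientAddGroup.mk_surjective x
      obtain ⟨n, h₁, h₂⟩ := (memG _).mp x.2
      refine AddSubgroup.mem_zmultiples_iff.mpr
        ⟨n, (QuotientAddGroup.eq (a := n • (⟨_, hg⟩ : G))).mpr ?_⟩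
      rw [AddSubgroup.mem_addSubgroupOf, memH]
      constructor
      · simpa [sub_eq_neg_add] using h₁
      · simpa [sub_eq_neg_add] using h₂
    have : IsAddCyclic (↥G ⧸ H.addSubgroupOf G) := ⟨q, hgen⟩
    have hcard : Nat.card (↥G ⧸ H.addSubgroupOf G) = p :=
      (addOrderOf_eq_card_of_forall_mem_zmultiples hgen).symm.trans hq
    exact ⟨(zmodAddCyclicAddEquiv inferInstance).symm.trans
      (ZMod.ringEquivCongr hcard).toAddEquiv⟩
  · rintro ⟨e⟩
    let e' : H →+ ℚ × ℚ := G.subtype.comp e.symm.toAddMonoidHom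
    let iA : A →+ H := ((AddMonoidHom.inl ℚ ℚ).comp A.subtype).codRestrict H
      fun a => (memH _).mpr ⟨a.2, B.zero_mem⟩
    let iB : B →+ H := ((AddMonoidHom.inr ℚ ℚ).comp B.subtype).codRestrict H
      fun b => (memH _).mpr ⟨A.zero_mem, b.2⟩
    have hA₂ (a : A) : (e' (iA a)).2 = 0 :=
      eq_zero_of_natCast_mul_mem hp.ne_zero hAB ((AddMonoidHom.snd ℚ ℚ).comp (e'.comp iA))
        (fun a => ((memG _).mp (e.symm (iA a)).2).elim
          fun _ h => natCast_mul_mem_of_sub_mem hp.ne_zero hB1 h.2) a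
    have hB₁ (b : B) : (e' (iB b)).1 = 0 :=
      eq_zero_of_natCast_mul_mem hp.ne_zero hBA ((AddMonoidHom.fst ℚ ℚ).comp (e'.comp iB))
        (fun b => ((memG _).mp (e.symm (iB b)).2).elim
          fun _ h => natCast_mul_mem_of_sub_mem hp.ne_zero hA1 h.1) b
    obtain ⟨ha, hb⟩ := (memH _).mp (e ⟨_, hg⟩).2
    have hsum : e ⟨_, hg⟩ = iA ⟨_, ha⟩ + iB ⟨_, hb⟩ := by
      ext <;> simp [iA, iB]
    have he : e' (e ⟨_, hg⟩) = ((1 / p : ℚ), (1 / p : ℚ)) := by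
      simp [e']
    rw [hsum, map_add] at he
    have h₁ : (e' (iA ⟨_, ha⟩)).1 = 1 / p := by
      simpa [hB₁] using congrArg Prod.fst he
    obtain ⟨n, hn₁, hn₂⟩ := (memG (e' (iA ⟨_, ha⟩))).mp (e.symm _).2
    rw [h₁] at hn₁
    rw [hA₂, zero_sub, neg_mem_iff] at hn₂
    obtain ⟨m, rfl⟩ := dvd_of_mul_one_div_mem hp hB1 hBp hn₂
    have hm : (((p : ℤ) * m : ℤ) : ℚ) * (1 / p) = m • (1 : ℚ) := by
      push_cast
      simp only [zsmul_eq_mul]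
      field_simp
    rw [hm] at hn₁
    exact hAp ((sub_add_cancel (1 / p : ℚ) (m • (1 : ℚ))) ▸ A.add_mem hn₁ (A.zsmul_mem hA1 m))
end
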